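/- Let μ be a Borel probability measure on Ω⁺ invariant under the shift S. If u is a prefix of the fixed point ω, then μ(C_u) ≥ μ(C_v) for every word v ∈ L(Ω) with |v| = |u|. Moreover, u is right-special if and only if μ(C_u) > μ(C_v) for every v ∈ L(Ω) with |v| = |u| and v ≠ u. -/

import Mathlib

/-- The substitution σ on the alphabet A = {1, …, d}:
σ(1) = 12, σ(k) = k+1 for 2 ≤ k ≤ d−1, σ(d) = 1. Letters are literal natural numbers. -/
def sig (d : ℕ) (a : ℕ) : List ℕ :=
  if a = 1 then [1, 2] else if a = d then [1] else [a + 1]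

/-- Extension of a substitution to finite words by concatenation. -/
def applySub (f : ℕ → List ℕ) : List ℕ → List ℕ
  | [] => []
  | a :: w => f a ++ applySub f w

/-- σⁿ applied to a word. -/
def sigIter (d n : ℕ) (w : List ℕ) : List ℕ := (applySub (sig d))^[n] w

/-- The language L(Ω): the set of finite factors of the fixed point ω, i.e. of the
words σⁿ(1). -/
def Lang (d : ℕ) (u : List ℕ) : Prop := ∃ n : ℕ, u <:+: sigIter d n [1]

/-- `w` is a (finite) prefix of the infinite word `V`. -/
def PrefixOfInf (w : List ℕ) (V : ℕ → ℕ) : Prop :=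
  ∀ (i : ℕ) (h : i < w.length), w.get ⟨i, h⟩ = V i

/-- `ω` is the fixed point of σ: the unique infinite word admitting every σⁿ(1) as a
prefix. -/
def IsSigmaFixedPoint (d : ℕ) (ω : ℕ → ℕ) : Prop :=
  ∀ n : ℕ, PrefixOfInf (sigIter d n [1]) ω

/-- `u` is left-special: there are distinct letters a, b ∈ A with au, bu ∈ L(Ω). -/
def LeftSpecial (d : ℕ) (u : List ℕ) : Prop :=
  ∃ a b : ℕ, a ≠ b ∧ 1 ≤ a ∧ a ≤ d ∧ 1 ≤ b ∧ b ≤ d ∧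
    Lang d (a :: u) ∧ Lang d (b :: u)

/-- `u` is right-special: there are distinct letters a, b ∈ A with ua, ub ∈ L(Ω). -/
def RightSpecial (d : ℕ) (u : List ℕ) : Prop :=
  ∃ a b : ℕ, a ≠ b ∧ 1 ≤ a ∧ a ≤ d ∧ 1 ≤ b ∧ b ≤ d ∧
    Lang d (u ++ [a]) ∧ Lang d (u ++ [b])

/-- `u` is bispecial: both left- and right-special. -/
def Bispecial (d : ℕ) (u : List ℕ) : Prop := LeftSpecial d u ∧ RightSpecial d u

/-- The shift S on infinite words. -/
def shiftMap (V : ℕ → ℕ) : ℕ → ℕ := fun i => V (i + 1)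

/-- Ω⁺ : the closure (for the product topology, letters discrete) of the shift
orbit of ω. -/
def OmegaPlus (ω : ℕ → ℕ) : Set (ℕ → ℕ) :=
  closure {V : ℕ → ℕ | ∃ n : ℕ, V = shiftMap^[n] ω}

/-- The cylinder C_u = {V ∈ Ω⁺ : u is a prefix of V}. -/
def Cyl (ω : ℕ → ℕ) (u : List ℕ) : Set (ℕ → ℕ) :=
  {V | V ∈ OmegaPlus ω ∧ PrefixOfInf u V}

/-- Prepending a letter to an infinite word. -/
def consInf (a : ℕ) (V : ℕ → ℕ) : ℕ → ℕ :=
  fun i => match i with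
  | 0 => a
  | j + 1 => V j

/-- Extension of σ to infinite words: σ(V) = σ(V₀)σ(V₁)σ(V₂)⋯ (each σ(a) is a
nonempty word, so the n-th letter of σ(V) is the n-th letter of σ(V₀…Vₙ)). -/
def sigInf (d : ℕ) (V : ℕ → ℕ) : ℕ → ℕ :=
  fun n => (applySub (sig d) ((List.range (n + 1)).map V)).getD n 0

/-- Concatenation of a finite list of words. -/
def concatAll : List (List ℕ) → List ℕ
  | [] => []
  | w :: ws => w ++ concatAll ws

/-! ### The fixed point as a sequence -/

theorem applySub_append (f : ℕ → List ℕ) (v w : List ℕ) :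
    applySub f (v ++ w) = applySub f v ++ applySub f w := by
  induction v with
  | nil => rfl
  | cons a v ih => simp [applySub, ih]

theorem sigIter_succ (d n : ℕ) (w : List ℕ) :
    sigIter d (n + 1) w = applySub (sig d) (sigIter d n w) :=
  Function.iterate_succ_apply' _ _ _

theorem length_sig_pos (d a : ℕ) : 0 < (sig d a).length := by
  unfold sig; split_ifs <;> simp

theorem length_le_length_applySub_sig (d : ℕ) (w : List ℕ) :
    w.length ≤ (applySub (sig d) w).length := by
  induction w with
  | nil => simp
  | cons a w ih =>
    have := length_sig_pos d a
    simp only [applySub, List.length_cons, List.length_append]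
    omega

theorem sigIter_eq_cons (d n : ℕ) : ∃ t : List ℕ, sigIter d n [1] = 1 :: t ∧ n ≤ t.length := by
  induction n with
  | zero => exact ⟨[], rfl, le_rfl⟩
  | succ n ih =>
    obtain ⟨t, ht, hn⟩ := ih
    refine ⟨2 :: applySub (sig d) t, ?_, ?_⟩
    · rw [sigIter_succ, ht]; simp [applySub, sig]
    · have := length_le_length_applySub_sig d t
      simp only [List.length_cons]; omega

theorem lt_length_sigIter (d n : ℕ) : n < (sigIter d n [1]).length := by
  obtain ⟨t, ht, hn⟩ := sigIter_eq_cons d n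
  rw [ht, List.length_cons]; omega

theorem sigIter_letters {d : ℕ} (hd : 2 ≤ d) (n : ℕ) :
    ∀ a ∈ sigIter d n [1], 1 ≤ a ∧ a ≤ d := by
  have key : ∀ w : List ℕ, (∀ a ∈ w, 1 ≤ a ∧ a ≤ d) →
      ∀ a ∈ applySub (sig d) w, 1 ≤ a ∧ a ≤ d := by
    intro w
    induction w with
    | nil => simp [applySub]
    | cons b w ih =>
      intro hw a ha
      have hb := hw b (by simp)
      rcases List.mem_append.1 ha with ha | ha
      · unfold sig at ha
        split_ifs at ha <;> simp at ha <;> omega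
      · exact ih (fun c hc => hw c (by simp [hc])) a ha
  induction n with
  | zero => intro a ha; simp [sigIter] at ha; omega
  | succ n ih => rw [sigIter_succ]; exact key _ ih

theorem prefixOfInf_append_left {v w : List ℕ} {V : ℕ → ℕ} (h : PrefixOfInf (v ++ w) V) :
    PrefixOfInf v V := by
  intro i hi
  have := h i (by rw [List.length_append]; omega)
  simpa [List.getElem_append_left hi] using this

theorem prefixOfInf_append_right {v w : List ℕ} {V : ℕ → ℕ} (h : PrefixOfInf (v ++ w) V)
    (i : ℕ) (hi : i < w.length) : w[i] = V (v.length + i) := by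
  have := h (v.length + i) (by rw [List.length_append]; omega)
  simpa using this

/-- The starting position in `σ(V)` of the image of the `j`-th letter of `V`. -/
def imagePos (V : ℕ → ℕ) : ℕ → ℕ
  | 0 => 0
  | j + 1 => imagePos V j + if V j = 1 then 2 else 1

theorem length_applySub_sig_of_prefix (d : ℕ) (V : ℕ → ℕ) (w : List ℕ) (hw : PrefixOfInf w V) :
    (applySub (sig d) w).length = imagePos V w.length := by
  induction w using List.reverseRecOn with
  | nil => rfl
  | append_singleton w a ih =>
    have ha : a = V w.length := by simpa using prefixOfInf_append_right hw 0 (by simp)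
    rw [applySub_append, List.length_append, ih (prefixOfInf_append_left hw), List.length_append]
    simp only [List.length_singleton, imagePos, ← ha, applySub, sig]
    split_ifs <;> simp

/-- `σ` applied to the `j`-th letter of the fixed point occurs at position `imagePos ω j`. -/
theorem IsSigmaFixedPoint.getElem_sig {d : ℕ} {ω : ℕ → ℕ} (hω : IsSigmaFixedPoint d ω) (j i : ℕ)
    (hi : i < (sig d (ω j)).length) : (sig d (ω j))[i] = ω (imagePos ω j + i) := by
  have hj := lt_length_sigIter d j
  set w := sigIter d j [1] with hw
  have h1 : PrefixOfInf w ω := hω j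
  have h2 : PrefixOfInf (applySub (sig d) w) ω := by
    rw [hw, ← sigIter_succ]; exact hω (j + 1)
  have hsplit : w = w.take j ++ (w[j] :: w.drop (j + 1)) := by
    rw [← List.drop_eq_getElem_cons hj, List.take_append_drop]
  have hwj : w[j] = ω j := by simpa using h1 j hj
  rw [hwj] at hsplit
  rw [hsplit] at h1
  have h3 := length_applySub_sig_of_prefix d ω _ (prefixOfInf_append_left h1)
  rw [List.length_take, min_eq_left hj.le] at h3
  rw [hsplit, applySub_append] at h2
  have h4 := prefixOfInf_append_right h2 i (by simp only [applySub, List.length_append]; omega)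
  rw [h3] at h4
  rw [← h4]
  simp [applySub, List.getElem_append_left hi]

section FixedPoint

variable {d : ℕ} {ω : ℕ → ℕ}

theorem IsSigmaFixedPoint.letters (hω : IsSigmaFixedPoint d ω) (hd : 2 ≤ d) (j : ℕ) :
    1 ≤ ω j ∧ ω j ≤ d := by
  have hj := lt_length_sigIter d j
  have := hω j j hj
  rw [← this]
  exact sigIter_letters hd j _ (List.get_mem _ _)

theorem IsSigmaFixedPoint.apply_zero (hω : IsSigmaFixedPoint d ω) : ω 0 = 1 := by
  have := hω 0 0 (by simp [sigIter])
  simpa [sigIter] using this.symm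

theorem IsSigmaFixedPoint.apply_imagePos (hω : IsSigmaFixedPoint d ω) (j : ℕ) :
    ω (imagePos ω j) = if ω j = 1 then 1 else if ω j = d then 1 else ω j + 1 := by
  have h := hω.getElem_sig j 0 (length_sig_pos _ _)
  rw [add_zero] at h
  rw [← h]
  simp only [sig]
  split_ifs <;> simp

theorem IsSigmaFixedPoint.apply_imagePos_add_one (hω : IsSigmaFixedPoint d ω) {j : ℕ}
    (hj : ω j = 1) : ω (imagePos ω j + 1) = 2 := by
  have h := hω.getElem_sig j 1 (by simp [sig, hj])
  rw [← h]
  simp [sig, hj]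

theorem imagePos_succ_of_eq {j : ℕ} (hj : ω j = 1) : imagePos ω (j + 1) = imagePos ω j + 2 := by
  simp [imagePos, hj]

theorem imagePos_succ_of_ne {j : ℕ} (hj : ω j ≠ 1) : imagePos ω (j + 1) = imagePos ω j + 1 := by
  simp [imagePos, hj]

theorem IsSigmaFixedPoint.lt_imagePos (hω : IsSigmaFixedPoint d ω) (j : ℕ) :
    j + 1 < imagePos ω (j + 1) := by
  induction j with
  | zero => simp [imagePos, hω.apply_zero]
  | succ j ih =>
    rw [imagePos]; split_ifs <;> omega

theorem exists_imagePos (V : ℕ → ℕ) (m : ℕ) :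
    ∃ j, m = imagePos V j ∨ (V j = 1 ∧ m = imagePos V j + 1) := by
  induction m with
  | zero => exact ⟨0, Or.inl rfl⟩
  | succ m ih =>
    obtain ⟨j, h | ⟨h1, h⟩⟩ := ih
    · by_cases hj : V j = 1
      · exact ⟨j, Or.inr ⟨hj, by omega⟩⟩
      · exact ⟨j + 1, Or.inl (by rw [imagePos_succ_of_ne hj]; omega)⟩
    · exact ⟨j + 1, Or.inl (by rw [imagePos_succ_of_eq h1]; omega)⟩

theorem IsSigmaFixedPoint.imagePos_ne_two (hω : IsSigmaFixedPoint d ω) (j : ℕ) :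
    ω (imagePos ω j) ≠ 2 := by
  rw [hω.apply_imagePos]; split_ifs <;> omega

/-- The last letter of `σ(ω j)`. -/
theorem IsSigmaFixedPoint.apply_imagePos_succ_pred (hω : IsSigmaFixedPoint d ω) (hd : 2 ≤ d)
    {j m : ℕ} (hm : m + 1 = imagePos ω (j + 1)) :
    ω m = if ω j = d then 1 else ω j + 1 := by
  by_cases hj : ω j = 1
  · rw [imagePos_succ_of_eq hj] at hm
    obtain rfl : m = imagePos ω j + 1 := by omega
    rw [hω.apply_imagePos_add_one hj, hj, if_neg (by omega)]
  · rw [imagePos_succ_of_ne hj] at hm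
    obtain rfl : m = imagePos ω j := by omega
    rw [hω.apply_imagePos, if_neg hj]

theorem IsSigmaFixedPoint.apply_succ (hω : IsSigmaFixedPoint d ω) (hd : 2 ≤ d) (m : ℕ) :
    ω (m + 1) = 1 ∨ ω (m + 1) = ω m + 1 := by
  induction m using Nat.strong_induction_on with
  | _ m ih =>
    obtain ⟨j, h | ⟨h1, h⟩⟩ := exists_imagePos ω (m + 1)
    · cases j with
      | zero => simp [imagePos] at h
      | succ j =>
        have hjm := hω.lt_imagePos j
        have hstep := ih j (by omega)
        have hlast := hω.apply_imagePos_succ_pred hd h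
        have hlet := hω.letters hd (j + 1)
        rw [h, hω.apply_imagePos, hlast]
        split_ifs <;> omega
    · obtain rfl : m = imagePos ω j := by omega
      right
      rw [hω.apply_imagePos_add_one h1, hω.apply_imagePos, if_pos h1]

theorem imagePos_add {j t : ℕ} (h : ∀ i < t, ω (j + i) = ω i) :
    imagePos ω (j + t) = imagePos ω j + imagePos ω t := by
  induction t with
  | zero => rfl
  | succ t ih =>
    rw [← add_assoc, imagePos, imagePos, ih (fun i hi => h i (by omega)), h t (by omega)]
    omega

theorem IsSigmaFixedPoint.agree_imagePos (hω : IsSigmaFixedPoint d ω) {j t : ℕ}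
    (h : ∀ i < t, ω (j + i) = ω i) :
    ∀ i < imagePos ω t, ω (imagePos ω j + i) = ω i := by
  induction t with
  | zero => intro i hi; simp [imagePos] at hi
  | succ t ih =>
    intro i hi
    have h' : ∀ i < t, ω (j + i) = ω i := fun i hi => h i (by omega)
    rcases lt_or_ge i (imagePos ω t) with hlt | hge
    · exact ih h' i hlt
    have ht := h t (by omega)
    have hpos := imagePos_add h'
    have e0 : ω (imagePos ω j + imagePos ω t) = ω (imagePos ω t) := by
      rw [← hpos, hω.apply_imagePos, hω.apply_imagePos, ht]
    by_cases h1 : ω t = 1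
    · rw [imagePos_succ_of_eq h1] at hi
      obtain rfl | rfl : i = imagePos ω t ∨ i = imagePos ω t + 1 := by omega
      · exact e0
      · rw [hω.apply_imagePos_add_one h1, ← add_assoc, ← hpos,
          hω.apply_imagePos_add_one (ht.trans h1)]
    · rw [imagePos_succ_of_ne h1] at hi
      obtain rfl : i = imagePos ω t := by omega
      exact e0

/-- Left-special words of the language are prefixes of the fixed point. -/
theorem IsSigmaFixedPoint.agree_of_leftSpecial (hω : IsSigmaFixedPoint d ω) (hd : 3 ≤ d) (n : ℕ) :
    ∀ q r : ℕ, (∀ i < n, ω (q + 1 + i) = ω (r + 1 + i)) → ω q ≠ ω r →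
      ∀ i < n, ω (q + 1 + i) = ω i := by
  have hd2 : 2 ≤ d := by omega
  induction n using Nat.strong_induction_on with
  | _ n ih =>
    intro q r hqr hne
    rcases Nat.eq_zero_or_pos n with rfl | hn
    · intro i hi; omega
    have hc : ω (q + 1) = 1 := by
      have h0 := hqr 0 hn
      simp only [add_zero] at h0
      have := hω.letters hd2 q
      have := hω.letters hd2 r
      rcases hω.apply_succ hd2 q with h | h <;> rcases hω.apply_succ hd2 r with h' | h' <;> omega
    have hc' : ω (r + 1) = 1 := by
      have h0 := hqr 0 hn
      simp only [add_zero] at h0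
      omega
    have hstart : ∀ m, ω (m + 1) = 1 → ∃ j, m + 1 = imagePos ω (j + 1) := by
      intro m hm
      obtain ⟨j, h | ⟨h1, h⟩⟩ := exists_imagePos ω (m + 1)
      · cases j with
        | zero => simp [imagePos] at h
        | succ j => exact ⟨j, h⟩
      · rw [h, hω.apply_imagePos_add_one h1] at hm; omega
    obtain ⟨j, hj⟩ := hstart q hc
    obtain ⟨k, hk⟩ := hstart r hc'
    have hjk : ω j ≠ ω k := by
      intro h
      apply hne
      rw [hω.apply_imagePos_succ_pred hd2 hj, hω.apply_imagePos_succ_pred hd2 hk, h]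
    by_cases hall : ∀ i < n - 1, ω (j + 1 + i) = ω (k + 1 + i)
    · have hag := ih (n - 1) (by omega) j k hall hjk
      have hag' := hω.agree_imagePos hag
      rcases Nat.lt_or_ge n 2 with h2 | h2
      · intro i hi
        obtain rfl : i = 0 := by omega
        rw [add_zero, hc, hω.apply_zero]
      · have hlt := hω.lt_imagePos (n - 2)
        have e : n - 2 + 1 = n - 1 := by omega
        rw [e] at hlt
        intro i hi
        rw [hj]
        exact hag' i (by omega)
    push Not at hall
    classical
    have hfind := Nat.find_spec hall
    set t := Nat.find hall
    obtain ⟨htn, htne⟩ := hfind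
    have hagjk : ∀ i < t, ω (j + 1 + i) = ω (k + 1 + i) := by
      intro i hi
      have := Nat.find_min hall hi
      by_contra hcon
      exact this ⟨by omega, hcon⟩
    have hagj := ih t (by omega) j k hagjk hjk
    have hagk : ∀ i < t, ω (k + 1 + i) = ω i := fun i hi => by rw [← hagjk i hi, hagj i hi]
    have hj' := hω.agree_imagePos hagj
    have pj := imagePos_add hagj
    have pk := imagePos_add hagk
    rcases le_or_gt n (imagePos ω t) with hle | hlt
    · intro i hi
      rw [hj]
      exact hj' i (by omega)
    have hfirst := hqr (imagePos ω t) hlt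
    rw [hj, hk, ← pj, ← pk] at hfirst
    have hfj := hω.apply_imagePos (j + 1 + t)
    have hfk := hω.apply_imagePos (k + 1 + t)
    have hlj := hω.letters hd2 (j + 1 + t)
    have hlk := hω.letters hd2 (k + 1 + t)
    have hcase : (ω (j + 1 + t) = 1 ∧ ω (k + 1 + t) = d) ∨
        (ω (j + 1 + t) = d ∧ ω (k + 1 + t) = 1) := by
      rw [hfj, hfk] at hfirst
      split_ifs at hfirst <;> omega
    have hnt : n = imagePos ω t + 1 := by
      by_contra hcon
      have hsecond := hqr (imagePos ω t + 1) (by omega)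
      rw [hj, hk, ← add_assoc, ← add_assoc, ← pj, ← pk] at hsecond
      rcases hcase with ⟨a, b⟩ | ⟨a, b⟩
      · rw [hω.apply_imagePos_add_one a, ← imagePos_succ_of_ne (by omega)] at hsecond
        exact hω.imagePos_ne_two _ hsecond.symm
      · rw [hω.apply_imagePos_add_one b, ← imagePos_succ_of_ne (by omega)] at hsecond
        exact hω.imagePos_ne_two _ hsecond
    have hωt : ω t = 1 ∨ ω t = d := by
      rcases Nat.eq_zero_or_pos t with h0 | hpos
      · rw [h0]; exact Or.inl hω.apply_zero
      obtain ⟨s, hs⟩ : ∃ s, t = s + 1 := ⟨t - 1, by omega⟩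
      have e1 := hagj s (by omega)
      have e2 := hagk s (by omega)
      have s0 := hω.apply_succ hd2 s
      have s1 := hω.apply_succ hd2 (j + 1 + s)
      have s2 := hω.apply_succ hd2 (k + 1 + s)
      rw [hs] at hcase ⊢
      simp only [← add_assoc] at hcase
      omega
    have hωpt : ω (imagePos ω t) = 1 := by
      rw [hω.apply_imagePos]
      rcases hωt with h | h <;> simp [h]
    intro i hi
    rcases lt_or_ge i (imagePos ω t) with h | h
    · rw [hj]; exact hj' i h
    · obtain rfl : i = imagePos ω t := by omega
      rw [hωpt, hj, ← pj, hfj]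
      rcases hcase with ⟨a, b⟩ | ⟨a, b⟩ <;> simp [a]

theorem IsSigmaFixedPoint.apply_one (hω : IsSigmaFixedPoint d ω) : ω 1 = 2 := by
  simpa [imagePos] using hω.apply_imagePos_add_one hω.apply_zero

theorem IsSigmaFixedPoint.exists_apply_eq (hω : IsSigmaFixedPoint d ω) {k : ℕ} (hk : 2 ≤ k)
    (hkd : k ≤ d) : ∃ j, ω j = k := by
  induction k, hk using Nat.le_induction with
  | base => exact ⟨1, hω.apply_one⟩
  | succ k hk ih =>
    obtain ⟨j, hj⟩ := ih (by omega)
    exact ⟨imagePos ω j, by rw [hω.apply_imagePos, hj, if_neg (by omega), if_neg (by omega)]⟩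

/-- The letter `1` is right-special. -/
theorem IsSigmaFixedPoint.exists_one_not_two (hω : IsSigmaFixedPoint d ω) (hd : 2 ≤ d) :
    ∃ q, ω q = 1 ∧ ω (q + 1) ≠ 2 := by
  obtain ⟨j, hj⟩ := hω.exists_apply_eq hd le_rfl
  refine ⟨imagePos ω j, by simp [hω.apply_imagePos, hj], ?_⟩
  rw [← imagePos_succ_of_ne (by omega)]
  exact hω.imagePos_ne_two _

theorem IsSigmaFixedPoint.lang_iff (hω : IsSigmaFixedPoint d ω) (w : List ℕ) :
    Lang d w ↔ ∃ q, ∀ (i : ℕ) (h : i < w.length), w[i] = ω (q + i) := by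
  constructor
  · rintro ⟨n, s, t, hst⟩
    have h := hω n
    rw [← hst] at h
    exact ⟨s.length, prefixOfInf_append_right (prefixOfInf_append_left h)⟩
  · rintro ⟨q, hq⟩
    refine ⟨q + w.length, ?_⟩
    have hlen := lt_length_sigIter d (q + w.length)
    have hpre := hω (q + w.length)
    set W := sigIter d (q + w.length) [1]
    have hw : w = (W.drop q).take w.length := by
      apply List.ext_getElem
      · simp; omega
      · intro i h1 h2
        rw [hq i h1, List.getElem_take, List.getElem_drop]
        exact (hpre (q + i) (by omega)).symm
    rw [hw]
    exact (List.take_prefix _ _).isInfix.trans (List.drop_suffix _ _).isInfix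

end FixedPoint

/-! ### Cylinders -/

/-- The cylinder of the factor of length `n` occurring at position `q` of `ω`. -/
def FactorCyl (ω : ℕ → ℕ) (q n : ℕ) : Set (ℕ → ℕ) :=
  {V | V ∈ OmegaPlus ω ∧ ∀ i < n, V i = ω (q + i)}

theorem cyl_eq_factorCyl {ω : ℕ → ℕ} {w : List ℕ} {q : ℕ}
    (h : ∀ (i : ℕ) (hi : i < w.length), w[i] = ω (q + i)) :
    Cyl ω w = FactorCyl ω q w.length := by
  ext V
  refine and_congr_right fun _ => forall₂_congr fun i hi => ?_
  rw [← h i hi]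
  exact eq_comm

theorem shiftMap_iterate (V : ℕ → ℕ) (n i : ℕ) : shiftMap^[n] V i = V (n + i) := by
  induction n generalizing V with
  | zero => simp
  | succ n ih =>
    rw [Function.iterate_succ_apply, ih]
    exact congrArg V (by omega)

theorem shiftMap_mem_omegaPlus {ω V : ℕ → ℕ} (h : V ∈ OmegaPlus ω) :
    shiftMap V ∈ OmegaPlus ω := by
  have hc : Continuous shiftMap := continuous_pi fun i => continuous_apply (i + 1)
  refine map_mem_closure hc h ?_
  rintro _ ⟨n, rfl⟩
  exact ⟨n + 1, (Function.iterate_succ_apply' _ _ _).symm⟩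

theorem exists_mem_factorCyl {ω V : ℕ → ℕ} (h : V ∈ OmegaPlus ω) (n : ℕ) :
    ∃ q, V ∈ FactorCyl ω q n := by
  have hopen : IsOpen {W : ℕ → ℕ | ∀ i < n, W i = V i} := by
    have : {W : ℕ → ℕ | ∀ i < n, W i = V i} = ⋂ i ∈ Set.Iio n, (fun W => W i) ⁻¹' {V i} := by
      ext W; simp
    rw [this]
    exact (Set.finite_Iio n).isOpen_biInter fun i _ =>
      (isOpen_discrete _).preimage (continuous_apply i)
  obtain ⟨W, hW, m, rfl⟩ := mem_closure_iff.1 h _ hopen (fun _ _ => rfl)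
  refine ⟨m, h, fun i hi => ?_⟩
  rw [← hW i hi, shiftMap_iterate]

theorem measurableSet_factorCyl (ω : ℕ → ℕ) (q n : ℕ) : MeasurableSet (FactorCyl ω q n) := by
  have : FactorCyl ω q n =
      OmegaPlus ω ∩ ⋂ i ∈ Set.Iio n, (fun W : ℕ → ℕ => W i) ⁻¹' {ω (q + i)} := by
    ext W; simp [FactorCyl]
  rw [this]
  exact isClosed_closure.measurableSet.inter <|
    MeasurableSet.biInter (Set.to_countable _) fun i _ =>
      measurable_pi_apply i (measurableSet_singleton _)

theorem factorCyl_subset {ω : ℕ → ℕ} {q r n N : ℕ} (hn : n ≤ N)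
    (h : ∀ i < n, ω (q + i) = ω (r + i)) : FactorCyl ω q N ⊆ FactorCyl ω r n :=
  fun _ hV => ⟨hV.1, fun i hi => (hV.2 i (by omega)).trans (h i hi)⟩

theorem disjoint_factorCyl {ω : ℕ → ℕ} {q r n : ℕ} (h : ω (q + n) ≠ ω (r + n)) :
    Disjoint (FactorCyl ω q (n + 1)) (FactorCyl ω r (n + 1)) :=
  Set.disjoint_left.2 fun _ h1 h2 =>
    h ((h1.2 n (by omega)).symm.trans (h2.2 n (by omega)))

section Measure

open MeasureTheory

variable {d : ℕ} {ω : ℕ → ℕ} {μ : Measure (ℕ → ℕ)}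

/-- Invariance of `μ` under the shift on `OmegaPlus ω`. -/
def ShiftInvariantOn (ω : ℕ → ℕ) (μ : Measure (ℕ → ℕ)) : Prop :=
  ∀ B : Set (ℕ → ℕ), MeasurableSet B → B ⊆ OmegaPlus ω →
    μ (shiftMap ⁻¹' B ∩ OmegaPlus ω) = μ B

theorem ShiftInvariantOn.measure_factorCyl (hinv : ShiftInvariantOn ω μ) (q n : ℕ) :
    μ (shiftMap ⁻¹' FactorCyl ω q n ∩ OmegaPlus ω) = μ (FactorCyl ω q n) :=
  hinv _ (measurableSet_factorCyl ω q n) fun _ hV => hV.1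

theorem ShiftInvariantOn.measure_le_succ (hinv : ShiftInvariantOn ω μ) (q n : ℕ) :
    μ (FactorCyl ω q (n + 1)) ≤ μ (FactorCyl ω (q + 1) n) := by
  rw [← hinv.measure_factorCyl (q + 1) n]
  refine measure_mono fun V hV => ⟨⟨shiftMap_mem_omegaPlus hV.1, fun i hi => ?_⟩, hV.1⟩
  rw [show q + 1 + i = q + (i + 1) by omega]
  exact hV.2 (i + 1) (by omega)

/-- A factor that is not a prefix of the fixed point has a unique left extension. -/
theorem ShiftInvariantOn.measure_succ_le (hinv : ShiftInvariantOn ω μ)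
    (hω : IsSigmaFixedPoint d ω) (hd : 3 ≤ d) {q n : ℕ}
    (h : ¬ ∀ i < n, ω (q + 1 + i) = ω i) :
    μ (FactorCyl ω (q + 1) n) ≤ μ (FactorCyl ω q (n + 1)) := by
  rw [← hinv.measure_factorCyl]
  refine measure_mono ?_
  rintro V ⟨hV, hVΩ⟩
  obtain ⟨r, -, hr⟩ := exists_mem_factorCyl hVΩ (n + 1)
  have hV' : ∀ i < n, V (i + 1) = ω (q + 1 + i) := hV.2
  have hq : ω q = ω r := by
    by_contra hne
    refine h (hω.agree_of_leftSpecial hd n q r (fun i hi => ?_) hne)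
    rw [← hV' i hi, hr (i + 1) (by omega)]
    exact congrArg ω (by omega)
  refine ⟨hVΩ, fun i hi => ?_⟩
  cases i with
  | zero => rw [hr 0 (by omega), add_zero, add_zero, hq]
  | succ i => rw [hV' i (by omega)]; exact congrArg ω (by omega)

theorem ShiftInvariantOn.measure_le_prefix (hinv : ShiftInvariantOn ω μ)
    (hω : IsSigmaFixedPoint d ω) (hd : 3 ≤ d) {n N : ℕ} (q : ℕ) (hN : n ≤ N) :
    μ (FactorCyl ω q N) ≤ μ (FactorCyl ω 0 n) := by
  induction q generalizing N with
  | zero => exact measure_mono (factorCyl_subset hN fun _ _ => rfl)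
  | succ q ih =>
    by_cases h : ∀ i < n, ω (q + 1 + i) = ω i
    · exact measure_mono (factorCyl_subset hN fun i hi => by rw [h i hi, zero_add])
    · exact (hinv.measure_succ_le hω hd fun h' => h fun i hi => h' i (by omega)).trans
        (ih (by omega))

theorem ShiftInvariantOn.measure_prefix_pos (hinv : ShiftInvariantOn ω μ)
    (hω : IsSigmaFixedPoint d ω) (hd : 3 ≤ d) (hμ : μ (OmegaPlus ω) ≠ 0) (n : ℕ) :
    0 < μ (FactorCyl ω 0 n) := by
  refine pos_iff_ne_zero.2 fun h0 => hμ ?_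
  refine measure_mono_null (t := ⋃ q, FactorCyl ω q n)
    (fun V hV => Set.mem_iUnion.2 (exists_mem_factorCyl hV n)) ?_
  refine measure_iUnion_null fun q => ?_
  exact le_antisymm ((hinv.measure_le_prefix hω hd q le_rfl).trans h0.le) zero_le

theorem ShiftInvariantOn.measure_pos (hinv : ShiftInvariantOn ω μ)
    (hω : IsSigmaFixedPoint d ω) (hd : 3 ≤ d) (hμ : μ (OmegaPlus ω) ≠ 0) (q n : ℕ) :
    0 < μ (FactorCyl ω q n) := by
  induction q generalizing n with
  | zero => exact hinv.measure_prefix_pos hω hd hμ n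
  | succ q ih => exact (ih (n + 1)).trans_le (hinv.measure_le_succ q n)

theorem ShiftInvariantOn.measure_lt_prefix [IsFiniteMeasure μ] (hinv : ShiftInvariantOn ω μ)
    (hω : IsSigmaFixedPoint d ω) (hd : 3 ≤ d) (hμ : μ (OmegaPlus ω) ≠ 0) {n a b : ℕ}
    (ha : ∀ i < n, ω (a + i) = ω i) (hb : ∀ i < n, ω (b + i) = ω i)
    (hab : ω (a + n) ≠ ω (b + n)) {N : ℕ} (q : ℕ) (hN : n + 1 ≤ N) :
    μ (FactorCyl ω q N) < μ (FactorCyl ω 0 n) := by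
  have key : ∀ q N, n + 1 ≤ N → (∀ i < n, ω (q + i) = ω i) →
      μ (FactorCyl ω q N) < μ (FactorCyl ω 0 n) := by
    intro q N hN hq
    obtain ⟨r, hr, hrq⟩ : ∃ r, (∀ i < n, ω (r + i) = ω i) ∧ ω (q + n) ≠ ω (r + n) := by
      by_cases h : ω (q + n) = ω (a + n)
      · exact ⟨b, hb, by rwa [h]⟩
      · exact ⟨a, ha, h⟩
    calc μ (FactorCyl ω q N) ≤ μ (FactorCyl ω q (n + 1)) :=
          measure_mono (factorCyl_subset hN fun _ _ => rfl)
      _ < μ (FactorCyl ω q (n + 1)) + μ (FactorCyl ω r (n + 1)) :=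
          ENNReal.lt_add_right (measure_ne_top _ _) (hinv.measure_pos hω hd hμ r (n + 1)).ne'
      _ = μ (FactorCyl ω q (n + 1) ∪ FactorCyl ω r (n + 1)) :=
          (measure_union (disjoint_factorCyl hrq) (measurableSet_factorCyl ω r (n + 1))).symm
      _ ≤ μ (FactorCyl ω 0 n) := measure_mono <| Set.union_subset
          (factorCyl_subset (by omega) fun i hi => by rw [hq i hi, zero_add])
          (factorCyl_subset (by omega) fun i hi => by rw [hr i hi, zero_add])
  induction q generalizing N with
  | zero => exact key 0 N hN fun i _ => by rw [zero_add]
  | succ q ih =>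
    by_cases h : ∀ i < n, ω (q + 1 + i) = ω i
    · exact key _ N hN h
    · exact (hinv.measure_succ_le hω hd fun h' => h fun i hi => h' i (by omega)).trans_lt
        (ih (by omega))

end Measure

theorem agree_of_getElem_append_singleton {u : List ℕ} {a q : ℕ} {ω : ℕ → ℕ}
    (hu : PrefixOfInf u ω)
    (h : ∀ (i : ℕ) (hi : i < (u ++ [a]).length), (u ++ [a])[i] = ω (q + i)) :
    (∀ i < u.length, ω (q + i) = ω i) ∧ ω (q + u.length) = a := by
  constructor
  · intro i hi
    rw [← h i (by rw [List.length_append]; omega), List.getElem_append_left hi]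
    exact hu i hi
  · rw [← h u.length (by simp)]
    simp

theorem getElem_append_singleton_of_agree {u : List ℕ} {q : ℕ} {ω : ℕ → ℕ}
    (hu : PrefixOfInf u ω) (h : ∀ i < u.length, ω (q + i) = ω i)
    (i : ℕ) (hi : i < (u ++ [ω (q + u.length)]).length) :
    (u ++ [ω (q + u.length)])[i] = ω (q + i) := by
  rcases lt_or_ge i u.length with hlt | hge
  · rw [List.getElem_append_left hlt, h i hlt]
    exact hu i hlt
  · obtain rfl : i = u.length := by simp at hi; omega
    simp

open MeasureTheory in
/-- Let μ be a shift-invariant Borel probability measure on Ω⁺. If u is a prefix of ω,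
then μ(C_u) ≥ μ(C_v) for every v ∈ L(Ω) with |v| = |u|; moreover u is right-special
iff μ(C_u) > μ(C_v) for every v ∈ L(Ω) with |v| = |u| and v ≠ u. -/
theorem stmt_15 (d : ℕ) (hd : 3 ≤ d) (ω : ℕ → ℕ) (hω : IsSigmaFixedPoint d ω)
    (μ : Measure (ℕ → ℕ)) [IsProbabilityMeasure μ]
    (hμΩ : μ (OmegaPlus ω) = 1)
    (hinv : ∀ B : Set (ℕ → ℕ), MeasurableSet B → B ⊆ OmegaPlus ω →
      μ (shiftMap ⁻¹' B ∩ OmegaPlus ω) = μ B)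
    (u : List ℕ) (hu : PrefixOfInf u ω) :
    (∀ v : List ℕ, Lang d v → v.length = u.length → μ (Cyl ω v) ≤ μ (Cyl ω u)) ∧
    (RightSpecial d u ↔
      ∀ v : List ℕ, Lang d v → v.length = u.length → v ≠ u →
        μ (Cyl ω v) < μ (Cyl ω u)) := by
  have hinv' : ShiftInvariantOn ω μ := hinv
  have hμ0 : μ (OmegaPlus ω) ≠ 0 := by rw [hμΩ]; exact one_ne_zero
  have hd2 : 2 ≤ d := by omega
  have hu0 : ∀ (i : ℕ) (hi : i < u.length), u[i] = ω (0 + i) := fun i hi => by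
    rw [zero_add]; exact hu i hi
  rw [cyl_eq_factorCyl hu0]
  refine ⟨fun v hv hlen => ?_, fun hrs v hv hlen hne => ?_, fun hlt => ?_⟩
  · obtain ⟨q, hq⟩ := (hω.lang_iff v).1 hv
    rw [cyl_eq_factorCyl hq, hlen]
    exact hinv'.measure_le_prefix hω hd q le_rfl
  · obtain ⟨a, b, hab, -, -, -, -, hLa, hLb⟩ := hrs
    obtain ⟨qa, hqa⟩ := (hω.lang_iff _).1 hLa
    obtain ⟨qb, hqb⟩ := (hω.lang_iff _).1 hLb
    obtain ⟨ha, ha'⟩ := agree_of_getElem_append_singleton hu hqa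
    obtain ⟨hb, hb'⟩ := agree_of_getElem_append_singleton hu hqb
    obtain ⟨q, hq⟩ := (hω.lang_iff v).1 hv
    rw [cyl_eq_factorCyl hq, hlen]
    have hnot : ¬ ∀ i < u.length, ω (q + i) = ω i := fun h => hne <|
      List.ext_getElem hlen fun i h1 h2 => by rw [hq i h1, hu0 i h2, h i h2, zero_add]
    cases q with
    | zero => exact absurd (fun i _ => by rw [zero_add]) hnot
    | succ q =>
      exact (hinv'.measure_succ_le hω hd hnot).trans_lt
        (hinv'.measure_lt_prefix hω hd hμ0 ha hb (by rw [ha', hb']; exact hab) q le_rfl)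
  · by_contra hrs
    have huniq : ∀ q, (∀ i < u.length, ω (q + i) = ω i) → ω (q + u.length) = ω u.length := by
      intro q hq
      by_contra hne
      have h0 : ∀ i < u.length, ω (0 + i) = ω i := fun i _ => by rw [zero_add]
      exact hrs ⟨ω (q + u.length), ω (0 + u.length), by rwa [zero_add],
        (hω.letters hd2 _).1, (hω.letters hd2 _).2, (hω.letters hd2 _).1, (hω.letters hd2 _).2,
        (hω.lang_iff _).2 ⟨q, getElem_append_singleton_of_agree hu hq⟩,
        (hω.lang_iff _).2 ⟨0, getElem_append_singleton_of_agree hu h0⟩⟩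
    have hlen2 : 2 ≤ u.length := by
      by_contra hcon
      obtain h | h : u.length = 0 ∨ u.length = 1 := by omega
      · have := huniq 1 (fun i hi => by omega)
        rw [h, add_zero, hω.apply_one, hω.apply_zero] at this
        omega
      · obtain ⟨q, hq1, hq2⟩ := hω.exists_one_not_two hd2
        have := huniq q fun i hi => by
          obtain rfl : i = 0 := by omega
          rw [add_zero, hq1, hω.apply_zero]
        rw [h, hω.apply_one] at this
        exact hq2 this
    set v := (List.range u.length).map fun i => ω (1 + i) with hv
    have hvlen : v.length = u.length := by simp [hv]
    have hvocc : ∀ (i : ℕ) (hi : i < v.length), v[i] = ω (1 + i) := fun i hi => by simp [hv]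
    have hvu : v ≠ u := by
      intro h
      have h1 := hvocc 0 (by omega)
      have h2 := hu0 0 (by omega)
      simp only [h] at h1
      rw [h1, add_zero, add_zero, hω.apply_one, hω.apply_zero] at h2
      omega
    refine absurd (hlt v ((hω.lang_iff v).2 ⟨1, hvocc⟩) hvlen hvu) (not_lt.2 ?_)
    rw [cyl_eq_factorCyl hvocc, hvlen]
    refine le_trans (measure_mono fun V hV => ?_) (hinv'.measure_le_succ 0 u.length)
    obtain ⟨q, -, hq⟩ := exists_mem_factorCyl hV.1 (u.length + 1)
    refine ⟨hV.1, fun i hi => ?_⟩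
    rcases Nat.lt_succ_iff_lt_or_eq.1 hi with h | rfl
    · exact hV.2 i h
    · rw [hq _ (by omega), zero_add]
      refine huniq q fun i hi => ?_
      rw [← hq i (by omega), hV.2 i hi, zero_add]
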